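/- Let n ≥ 3, let 0 ≤ a < (n−2)/2, a ≤ b ≤ a+1, and set p = 2n/(n−2+2(b−a)). Then there exists a constant C > 0 (depending only on n, a, b) such that for every smooth compactly supported function u : ℝⁿ → ℝ one has the Caffarelli–Kohn–Nirenberg inequality C (∫_{ℝⁿ} |x|^{−bp} |u(x)|ᵖ dx)^{2/p} ≤ ∫_{ℝⁿ} |x|^{−2a} |∇u(x)|² dx. -/

import Mathlib

open MeasureTheory
open scoped ENNReal NNReal

/-- Integration by parts against the radial vector field: `∫ div (g(x) x) dx = 0`. -/
theorem integral_natCast_mul_add_fderiv_apply_self {n : ℕ} {g : EuclideanSpace ℝ (Fin n) → ℝ}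
    (hg : ContDiff ℝ 1 g) (hgs : HasCompactSupport g) :
    Integrable (fun x => n * g x + fderiv ℝ g x x) ∧
      ∫ x, (n * g x + fderiv ℝ g x x) = 0 := by
  have hg' : Continuous (fderiv ℝ g) := hg.continuous_fderiv one_ne_zero
  have hgi : Integrable g := hg.continuous.integrable_of_hasCompactSupport hgs
  let e : Fin n → EuclideanSpace ℝ (Fin n) := fun i => EuclideanSpace.single i 1
  have hproj : ∀ i (x : EuclideanSpace ℝ (Fin n)),
      fderiv ℝ (fun y : EuclideanSpace ℝ (Fin n) => y i) x (e i) = 1 := by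
    intro i x
    have : HasFDerivAt (fun y : EuclideanSpace ℝ (Fin n) => y i)
        (EuclideanSpace.proj (𝕜 := ℝ) i) x :=
      (EuclideanSpace.proj (𝕜 := ℝ) i).hasFDerivAt
    rw [this.fderiv]
    simp [e]
  have hi : ∀ i, Integrable (fun x : EuclideanSpace ℝ (Fin n) => x i * fderiv ℝ g x (e i)) := by
    intro i
    refine Continuous.integrable_of_hasCompactSupport (by fun_prop) ?_
    exact (hgs.fderiv_apply ℝ (e i)).mul_left
  have hpart : ∀ i, ∫ x : EuclideanSpace ℝ (Fin n), x i * fderiv ℝ g x (e i) = - ∫ x, g x := by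
    intro i
    have := integral_mul_fderiv_eq_neg_fderiv_mul_of_integrable (μ := volume)
      (f := fun y : EuclideanSpace ℝ (Fin n) => y i) (g := g) (v := e i)
      (by simpa [hproj] using hgi) (hi i)
      (Continuous.integrable_of_hasCompactSupport (by fun_prop) hgs.mul_left)
      (fun x _ => (EuclideanSpace.proj (𝕜 := ℝ) i).differentiableAt)
      (fun x _ => hg.differentiable one_ne_zero x)
    simpa [hproj] using this
  have hsum : ∀ x, fderiv ℝ g x x = ∑ i, x i * fderiv ℝ g x (e i) := by
    intro x
    have hx : x = ∑ i, x i • e i := by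
      simpa [e] using ((EuclideanSpace.basisFun (Fin n) ℝ).sum_repr x).symm
    conv_lhs => rw [hx, map_sum]
    rw [← hx]
    simp
  simp_rw [hsum]
  have hS : Integrable (fun x : EuclideanSpace ℝ (Fin n) =>
      ∑ i, x i * fderiv ℝ g x (e i)) := integrable_finsetSum _ fun i _ => hi i
  refine ⟨(hgi.const_mul _).add hS, ?_⟩
  rw [integral_add (hgi.const_mul _) hS, integral_finsetSum _ fun i _ => hi i, integral_const_mul]
  simp [hpart]

theorem hasFDerivAt_norm_sq_add_rpow {E : Type*} [NormedAddCommGroup E] [InnerProductSpace ℝ E]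
    {ε : ℝ} (hε : 0 < ε) (s : ℝ) (x : E) :
    HasFDerivAt (fun y : E => (‖y‖ ^ 2 + ε) ^ s)
      ((2 * s * (‖x‖ ^ 2 + ε) ^ (s - 1)) • innerSL ℝ x) x := by
  have h := ((hasStrictFDerivAt_norm_sq x).hasFDerivAt.add_const ε).rpow_const (p := s)
    (Or.inl (by positivity))
  convert h using 1
  ext y
  simp
  ring

theorem contDiff_norm_sq_add_rpow {E : Type*} [NormedAddCommGroup E] [InnerProductSpace ℝ E]
    {ε : ℝ} (hε : 0 < ε) (s : ℝ) {k : WithTop ℕ∞} :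
    ContDiff ℝ k (fun y : E => (‖y‖ ^ 2 + ε) ^ s) :=
  ((contDiff_norm_sq ℝ).add contDiff_const).rpow_const_of_ne fun x => by positivity

theorem integrable_norm_sq_add_rpow_mul {n : ℕ} {ε : ℝ} (hε : 0 < ε) (s : ℝ)
    {f : EuclideanSpace ℝ (Fin n) → ℝ} (hfs : HasCompactSupport f) (hf : Continuous f) :
    Integrable fun x => (‖x‖ ^ 2 + ε) ^ s * f x :=
  ((contDiff_norm_sq_add_rpow (k := 0) hε s).continuous.mul hf).integrable_of_hasCompactSupport
    hfs.mul_left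

theorem HasCompactSupport.sq {X : Type*} [TopologicalSpace X] {u : X → ℝ}
    (hus : HasCompactSupport u) : HasCompactSupport fun x => u x ^ 2 :=
  hus.comp_left (g := (· ^ 2)) (by simp)

theorem HasCompactSupport.norm_fderiv_sq {E : Type*} [NormedAddCommGroup E] [NormedSpace ℝ E]
    {u : E → ℝ} (hus : HasCompactSupport u) : HasCompactSupport fun x => ‖fderiv ℝ u x‖ ^ 2 :=
  (hus.fderiv ℝ).comp_left (g := fun L => ‖L‖ ^ 2) (by simp)

/-- A weighted **Hardy inequality**, with the weight `‖x‖ ^ 2` regularized to `‖x‖ ^ 2 + ε`. -/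
theorem integral_rpow_mul_sq_le {n : ℕ} {ε : ℝ} (hε : 0 < ε) {a : ℝ} (ha : -1 ≤ a)
    (han : 2 * (a + 1) < n) {u : EuclideanSpace ℝ (Fin n) → ℝ}
    (hu : ContDiff ℝ 1 u) (hus : HasCompactSupport u) :
    ∫ x, (‖x‖ ^ 2 + ε) ^ (-(a + 1)) * u x ^ 2 ≤
      (2 / (n - 2 * (a + 1))) ^ 2 * ∫ x, (‖x‖ ^ 2 + ε) ^ (-a) * ‖fderiv ℝ u x‖ ^ 2 := by
  set d : ℝ := n - 2 * (a + 1) with hd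
  have hd0 : 0 < d := by linarith
  have hI1 := integrable_norm_sq_add_rpow_mul hε (-(a + 1)) hus.sq (hu.continuous.pow 2)
  have hI2 := integrable_norm_sq_add_rpow_mul hε (-a) hus.norm_fderiv_sq
    ((hu.continuous_fderiv one_ne_zero).norm.pow 2)
  obtain ⟨hJ, hJ0⟩ := integral_natCast_mul_add_fderiv_apply_self
    (g := fun x => (‖x‖ ^ 2 + ε) ^ (-(a + 1)) * u x ^ 2)
    ((contDiff_norm_sq_add_rpow hε _).mul (hu.pow 2)) hus.sq.mul_left
  have key : 0 ≤ ∫ x, (2 / d * ((‖x‖ ^ 2 + ε) ^ (-a) * ‖fderiv ℝ u x‖ ^ 2)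
      - d / 2 * ((‖x‖ ^ 2 + ε) ^ (-(a + 1)) * u x ^ 2)) := by
    rw [← neg_zero, ← hJ0, ← integral_neg]
    refine integral_mono hJ.neg ((hI2.const_mul _).sub (hI1.const_mul _)) fun x => ?_
    have hr : 0 < ‖x‖ ^ 2 + ε := by positivity
    have hD : fderiv ℝ (fun x => (‖x‖ ^ 2 + ε) ^ (-(a + 1)) * u x ^ 2) x x =
        (‖x‖ ^ 2 + ε) ^ (-(a + 1)) * (2 * u x * fderiv ℝ u x x)
        - 2 * (a + 1) * (‖x‖ ^ 2 + ε) ^ (-(a + 1) - 1) * ‖x‖ ^ 2 * u x ^ 2 := by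
      have h1 := (hasFDerivAt_norm_sq_add_rpow hε (-(a + 1)) x).fun_mul
        ((hu.differentiable one_ne_zero x).hasFDerivAt.pow 2)
      rw [h1.fderiv]
      simp
      ring
    simp only [hD]
    set R := (‖x‖ ^ 2 + ε) ^ (-(a + 1)) with hR
    have hR0 : 0 < R := Real.rpow_pos_of_pos hr _
    have e1 : (‖x‖ ^ 2 + ε) ^ (-a) = R * (‖x‖ ^ 2 + ε) := by
      rw [hR, ← Real.rpow_add_one hr.ne']; congr 1; ring
    have e2 : (‖x‖ ^ 2 + ε) ^ (-(a + 1) - 1) * ‖x‖ ^ 2 ≤ R := by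
      rw [Real.rpow_sub_one hr.ne', div_mul_eq_mul_div, div_le_iff₀ hr]
      exact mul_le_mul_of_nonneg_left (by linarith) hR0.le
    have e3 : |fderiv ℝ u x x| ≤ ‖fderiv ℝ u x‖ * ‖x‖ := (fderiv ℝ u x).le_opNorm x
    have e4 : fderiv ℝ u x x ^ 2 ≤ ‖fderiv ℝ u x‖ ^ 2 * (‖x‖ ^ 2 + ε) := by
      calc _ = |fderiv ℝ u x x| ^ 2 := (sq_abs _).symm
        _ ≤ (‖fderiv ℝ u x‖ * ‖x‖) ^ 2 := by gcongr
        _ = ‖fderiv ℝ u x‖ ^ 2 * ‖x‖ ^ 2 := mul_pow _ _ _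
        _ ≤ _ := by gcongr; linarith
    have e5 : -(2 * u x * fderiv ℝ u x x) ≤ d / 2 * u x ^ 2 + 2 / d * fderiv ℝ u x x ^ 2 := by
      have : d / 2 * u x ^ 2 + 2 / d * fderiv ℝ u x x ^ 2 + (2 * u x * fderiv ℝ u x x)
        = 2 / d * (d / 2 * u x + fderiv ℝ u x x) ^ 2 := by field_simp; ring
      have : 0 ≤ 2 / d * (d / 2 * u x + fderiv ℝ u x x) ^ 2 := by positivity
      linarith
    have e6 := mul_le_mul_of_nonneg_right e2
      (show 0 ≤ 2 * (a + 1) * u x ^ 2 by have : 0 ≤ a + 1 := by linarith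
                                         positivity)
    have e7 : R * (-(2 * u x * fderiv ℝ u x x)) ≤
        R * (d / 2 * u x ^ 2 + 2 / d * (‖fderiv ℝ u x‖ ^ 2 * (‖x‖ ^ 2 + ε))) := by
      refine mul_le_mul_of_nonneg_left (e5.trans ?_) hR0.le
      gcongr
    rw [e1]
    have hn : (n : ℝ) = d + 2 * (a + 1) := by rw [hd]; ring
    rw [hn]
    linarith
  rw [integral_sub (hI2.const_mul _) (hI1.const_mul _), integral_const_mul,
    integral_const_mul] at key
  have := mul_le_mul_of_nonneg_left (sub_nonneg.1 key) (show 0 ≤ 2 / d by positivity)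
  calc _ = 2 / d * (d / 2 * ∫ x, (‖x‖ ^ 2 + ε) ^ (-(a + 1)) * u x ^ 2) := by field_simp
    _ ≤ _ := this
    _ = _ := by ring

/-- The **Sobolev inequality** for the critical exponent `2n/(n-2)`, in integral form. -/
theorem exists_lintegral_rpow_le_integral_fderiv_sq {n : ℕ} (hn : 3 ≤ n) {q : ℝ}
    (hq : q = 2 * n / (n - 2)) :
    ∃ K : ℝ≥0, ∀ w : EuclideanSpace ℝ (Fin n) → ℝ, ContDiff ℝ 1 w → HasCompactSupport w →
      ∫⁻ x, ‖w x‖ₑ ^ q ≤ K * ENNReal.ofReal (∫ x, ‖fderiv ℝ w x‖ ^ 2) ^ (q / 2) := by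
  have hn3 : (3 : ℝ) ≤ n := by exact_mod_cast hn
  have hn2 : (0 : ℝ) < n - 2 := by linarith
  have hq0 : 0 < q := by rw [hq]; positivity
  obtain ⟨q, rfl⟩ : ∃ q' : ℝ≥0, q = q' := ⟨⟨q, hq0.le⟩, rfl⟩
  obtain ⟨S, hS⟩ : ∃ S : ℝ≥0, ∀ w : EuclideanSpace ℝ (Fin n) → ℝ, ContDiff ℝ 1 w →
      HasCompactSupport w →
      eLpNorm w q volume ≤ S * eLpNorm (fderiv ℝ w) (2 : ℝ≥0) volume := by
    refine ⟨_, fun w hw hws => eLpNorm_le_eLpNorm_fderiv_of_eq volume hw hws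
      one_le_two (by simp; lia) ?_⟩
    rw [hq, finrank_euclideanSpace_fin]
    push_cast
    field_simp
  refine ⟨S ^ (q : ℝ), fun w hw hws => ?_⟩
  have h := hS w hw hws
  have hq0' : q ≠ 0 := by rintro rfl; simp at hq0
  have hw' : Continuous (fderiv ℝ w) := hw.continuous_fderiv one_ne_zero
  have hI : Integrable fun x => ‖fderiv ℝ w x‖ ^ 2 :=
    (hw'.norm.pow 2).integrable_of_hasCompactSupport hws.norm_fderiv_sq
  have h2 : eLpNorm (fderiv ℝ w) (2 : ℝ≥0) volume =
      ENNReal.ofReal (∫ x, ‖fderiv ℝ w x‖ ^ 2) ^ (1 / 2 : ℝ) := by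
    rw [eLpNorm_nnreal_eq_lintegral two_ne_zero,
      ofReal_integral_eq_lintegral_ofReal hI (ae_of_all _ fun x => by positivity)]
    simp [ENNReal.ofReal_pow]
  rw [← eLpNorm_nnreal_pow_eq_lintegral hq0']
  calc _ ≤ _ := ENNReal.rpow_le_rpow h hq0.le
    _ = _ := by
      rw [ENNReal.mul_rpow_of_nonneg _ _ hq0.le, h2, ← ENNReal.rpow_mul,
        ENNReal.coe_rpow_of_nonneg _ hq0.le]
      congr 2
      ring

theorem integral_fderiv_rpow_mul_sq_le {n : ℕ} {ε : ℝ} (hε : 0 < ε) {a : ℝ} (ha : -1 ≤ a)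
    (han : 2 * (a + 1) < n) {u : EuclideanSpace ℝ (Fin n) → ℝ}
    (hu : ContDiff ℝ 1 u) (hus : HasCompactSupport u) :
    ∫ x, ‖fderiv ℝ (fun y => (‖y‖ ^ 2 + ε) ^ (-(a / 2)) * u y) x‖ ^ 2 ≤
      (2 + 2 * a ^ 2 * (2 / (n - 2 * (a + 1))) ^ 2) *
        ∫ x, (‖x‖ ^ 2 + ε) ^ (-a) * ‖fderiv ℝ u x‖ ^ 2 := by
  have hI1 := integrable_norm_sq_add_rpow_mul hε (-(a + 1)) hus.sq (hu.continuous.pow 2)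
  have hI2 := integrable_norm_sq_add_rpow_mul hε (-a) hus.norm_fderiv_sq
    ((hu.continuous_fderiv one_ne_zero).norm.pow 2)
  have key : ∫ x, ‖fderiv ℝ (fun y => (‖y‖ ^ 2 + ε) ^ (-(a / 2)) * u y) x‖ ^ 2 ≤
      ∫ x, (2 * ((‖x‖ ^ 2 + ε) ^ (-a) * ‖fderiv ℝ u x‖ ^ 2) +
        2 * a ^ 2 * ((‖x‖ ^ 2 + ε) ^ (-(a + 1)) * u x ^ 2)) := by
    refine integral_mono_of_nonneg (ae_of_all _ fun x => by positivity)
      ((hI2.const_mul _).add (hI1.const_mul _)) (ae_of_all _ fun x => ?_)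
    have hr : 0 < ‖x‖ ^ 2 + ε := by positivity
    have h1 := (hasFDerivAt_norm_sq_add_rpow hε (-(a / 2)) x).fun_mul
        (hu.differentiable one_ne_zero x).hasFDerivAt
    simp only [h1.fderiv]
    set r := ‖x‖ ^ 2 + ε with hrd
    have e1 : r ^ (-a) = (r ^ (-(a / 2))) ^ 2 := by
      rw [← Real.rpow_mul_natCast hr.le]; congr 1; push_cast; ring
    have e2 : r ^ (-(a + 1)) = (r ^ (-(a / 2) - 1)) ^ 2 * r := by
      rw [← Real.rpow_mul_natCast hr.le, ← Real.rpow_add_one hr.ne']; congr 1; push_cast; ring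
    rw [e1, e2]
    have hA : 0 < r ^ (-(a / 2)) := Real.rpow_pos_of_pos hr _
    have hB : 0 < r ^ (-(a / 2) - 1) := Real.rpow_pos_of_pos hr _
    set A := r ^ (-(a / 2))
    set B := r ^ (-(a / 2) - 1)
    have hnorm : ‖A • fderiv ℝ u x + u x • (2 * -(a / 2) * B) • innerSL ℝ x‖ ≤
        A * ‖fderiv ℝ u x‖ + |u x| * (|a| * B) * ‖x‖ := by
      refine (norm_add_le _ _).trans_eq ?_
      rw [norm_smul, norm_smul, norm_smul, innerSL_apply_norm, Real.norm_of_nonneg hA.le,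
        Real.norm_eq_abs, Real.norm_eq_abs, abs_mul _ B, abs_of_pos hB,
        show 2 * -(a / 2) = -a by ring, abs_neg]
      ring
    calc _ ≤ (A * ‖fderiv ℝ u x‖ + |u x| * (|a| * B) * ‖x‖) ^ 2 := by gcongr
      _ ≤ 2 * ((A * ‖fderiv ℝ u x‖) ^ 2 + (|u x| * (|a| * B) * ‖x‖) ^ 2) := add_sq_le
      _ = 2 * (A ^ 2 * ‖fderiv ℝ u x‖ ^ 2) + 2 * a ^ 2 * (B ^ 2 * ‖x‖ ^ 2 * u x ^ 2) := by
        rw [← sq_abs a, ← sq_abs (u x)]; ring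
      _ ≤ _ := by gcongr; linarith
  refine key.trans ?_
  rw [integral_add (hI2.const_mul _) (hI1.const_mul _), integral_const_mul, integral_const_mul,
    add_mul, mul_assoc (2 * a ^ 2)]
  gcongr
  exact integral_rpow_mul_sq_le hε ha han hu hus

/-- The Caffarelli–Kohn–Nirenberg inequality for the regularized weight, with a constant independent
of `ε`: interpolate between the Hardy and the Sobolev inequality. -/
theorem exists_lintegral_regularized_le {n : ℕ} (hn : 3 ≤ n) {a b p : ℝ} (ha0 : 0 ≤ a)
    (han : 2 * (a + 1) < n) (hab : a ≤ b) (hba : b ≤ a + 1)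
    (hp : p = 2 * n / (n - 2 + 2 * (b - a))) :
    ∃ M : ℝ≥0, ∀ ε > 0, ∀ u : EuclideanSpace ℝ (Fin n) → ℝ,
      ContDiff ℝ 1 u → HasCompactSupport u →
      ∫⁻ x, ENNReal.ofReal ((‖x‖ ^ 2 + ε) ^ (-(b * p / 2)) * |u x| ^ p) ≤
        M * ENNReal.ofReal (∫ x, (‖x‖ ^ 2 + ε) ^ (-a) * ‖fderiv ℝ u x‖ ^ 2) ^ (p / 2) := by
  have hn3 : (3 : ℝ) ≤ n := by exact_mod_cast hn
  have hn2 : (0 : ℝ) < n - 2 := by linarith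
  have hden : (0 : ℝ) < n - 2 + 2 * (b - a) := by linarith
  have hp0 : 0 < p := by rw [hp]; positivity
  obtain ⟨q, hq⟩ : ∃ q : ℝ, q = 2 * n / (n - 2) := ⟨_, rfl⟩
  have hq0 : 0 < q := by rw [hq]; positivity
  obtain ⟨l, hl⟩ : ∃ l : ℝ, l = (b - a) * p / 2 := ⟨_, rfl⟩
  have hl0 : 0 ≤ l := by rw [hl]; have := sub_nonneg.2 hab; positivity
  have hl1 : 0 ≤ 1 - l := by
    have : 1 - l = (n - 2) * (a + 1 - b) / (n - 2 + 2 * (b - a)) := by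
      have hpD : p * (n - 2 + 2 * (b - a)) = 2 * n := by rw [hp, div_mul_cancel₀ _ hden.ne']
      rw [eq_div_iff hden.ne', hl]
      linear_combination (-(b - a) / 2) * hpD
    rw [this]
    have := sub_nonneg.2 hba
    positivity
  have hpl : 2 * l + q * (1 - l) = p := by rw [hl, hq, hp]; field_simp; ring
  have hbl : (a + 1) * l + a / 2 * q * (1 - l) = b * p / 2 := by
    rw [mul_assoc, eq_sub_of_add_eq' hpl, hl]; ring
  obtain ⟨K, hK⟩ := exists_lintegral_rpow_le_integral_fderiv_sq hn hq
  set c₁ : ℝ≥0 := (2 / (n - 2 * (a + 1)) : ℝ).toNNReal ^ 2 with hc₁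
  set c₂ : ℝ≥0 := (2 + 2 * a ^ 2 * (2 / (n - 2 * (a + 1))) ^ 2 : ℝ).toNNReal with hc₂
  refine ⟨c₁ ^ l * (K * c₂ ^ (q / 2)) ^ (1 - l), fun ε hε u hu hus => ?_⟩
  set G := ∫ x, (‖x‖ ^ 2 + ε) ^ (-a) * ‖fderiv ℝ u x‖ ^ 2 with hG
  have hd0 : 0 < n - 2 * (a + 1) := by linarith
  have hI1 := integrable_norm_sq_add_rpow_mul hε (-(a + 1)) hus.sq (hu.continuous.pow 2)
  have hwc : ContDiff ℝ 1 fun x => (‖x‖ ^ 2 + ε) ^ (-(a / 2)) * u x :=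
    (contDiff_norm_sq_add_rpow hε _).mul hu
  have hardy : ∫⁻ x, ENNReal.ofReal ((‖x‖ ^ 2 + ε) ^ (-(a + 1)) * u x ^ 2) ≤
      c₁ * ENNReal.ofReal G := by
    rw [← ofReal_integral_eq_lintegral_ofReal hI1 (ae_of_all _ fun x => by positivity)]
    refine (ENNReal.ofReal_le_ofReal
      (integral_rpow_mul_sq_le hε (by linarith) han hu hus)).trans_eq ?_
    rw [ENNReal.ofReal_mul (by positivity), ENNReal.ofReal_pow (by positivity), hc₁]
    rfl
  have sobolev : ∫⁻ x, ‖(‖x‖ ^ 2 + ε) ^ (-(a / 2)) * u x‖ₑ ^ q ≤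
      K * (c₂ * ENNReal.ofReal G) ^ (q / 2) := by
    refine (hK _ hwc hus.mul_left).trans ?_
    gcongr
    refine (ENNReal.ofReal_le_ofReal
      (integral_fderiv_rpow_mul_sq_le hε (by linarith) han hu hus)).trans_eq ?_
    rw [ENNReal.ofReal_mul (by positivity), hc₂]
    rfl
  have hpt : ∀ x, ENNReal.ofReal ((‖x‖ ^ 2 + ε) ^ (-(b * p / 2)) * |u x| ^ p) =
      ENNReal.ofReal ((‖x‖ ^ 2 + ε) ^ (-(a + 1)) * u x ^ 2) ^ l *
        (‖(‖x‖ ^ 2 + ε) ^ (-(a / 2)) * u x‖ₑ ^ q) ^ (1 - l) := by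
    intro x
    have hr : 0 < ‖x‖ ^ 2 + ε := by positivity
    rw [← ofReal_norm, norm_mul, Real.norm_of_nonneg (Real.rpow_nonneg hr.le _), Real.norm_eq_abs,
      ENNReal.ofReal_rpow_of_nonneg (by positivity) hl0,
      ENNReal.ofReal_rpow_of_nonneg (by positivity) hq0.le,
      ENNReal.ofReal_rpow_of_nonneg (by positivity) hl1,
      ← ENNReal.ofReal_mul (by positivity)]
    congr 1
    rw [← sq_abs (u x), ← Real.rpow_natCast |u x| 2,
      Real.mul_rpow (by positivity) (by positivity), Real.mul_rpow (by positivity) (by positivity),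
      Real.mul_rpow (by positivity) (by positivity), ← Real.rpow_mul hr.le, ← Real.rpow_mul hr.le,
      ← Real.rpow_mul hr.le, ← Real.rpow_mul (abs_nonneg _), ← Real.rpow_mul (abs_nonneg _),
      mul_mul_mul_comm, ← Real.rpow_add hr,
      ← Real.rpow_add_of_nonneg (abs_nonneg _) (by positivity) (by positivity)]
    congr 2
    · linarith
    · push_cast; linarith
  simp_rw [hpt]
  refine (ENNReal.lintegral_mul_norm_pow_le hI1.aemeasurable.ennreal_ofReal
    (hwc.continuous.measurable.enorm.pow_const q).aemeasurable hl0 hl1 (by ring)).trans ?_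
  calc _ ≤ (c₁ * ENNReal.ofReal G) ^ l * (K * (c₂ * ENNReal.ofReal G) ^ (q / 2)) ^ (1 - l) := by
        gcongr
    _ = _ := by
      rw [ENNReal.mul_rpow_of_nonneg _ _ hl0, ENNReal.mul_rpow_of_nonneg _ (ENNReal.ofReal G)
        (by positivity : 0 ≤ q / 2), ← mul_assoc (K : ℝ≥0∞), ENNReal.mul_rpow_of_nonneg _ _ hl1,
        mul_mul_mul_comm, ← ENNReal.rpow_mul,
        ← ENNReal.rpow_add_of_nonneg _ _ hl0 (by positivity)]
      push_cast [ENNReal.coe_rpow_of_nonneg _ hl0, ENNReal.coe_rpow_of_nonneg _ hl1,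
        ENNReal.coe_rpow_of_nonneg _ (by positivity : 0 ≤ q / 2)]
      congr 2
      linarith

theorem integrable_norm_rpow_mul_norm_fderiv_sq {n : ℕ} {a : ℝ} (hn : 1 ≤ n) (han : 2 * a < n)
    {u : EuclideanSpace ℝ (Fin n) → ℝ} (hu : ContDiff ℝ 1 u) (hus : HasCompactSupport u) :
    Integrable fun x => ‖x‖ ^ (-(2 * a)) * ‖fderiv ℝ u x‖ ^ 2 := by
  have hloc : LocallyIntegrable fun x : EuclideanSpace ℝ (Fin n) => ‖x‖ ^ (-(2 * a)) :=
    locallyIntegrable_of_norm_le_rpow (C := 1) (α := 2 * a) (by simpa using hn) (by simpa using han)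
      (ae_of_all _ fun x => by
        rw [Real.norm_of_nonneg (Real.rpow_nonneg (norm_nonneg _) _), one_mul])
      (measurable_norm.pow_const _).aestronglyMeasurable
  have := hloc.integrable_smul_right_of_hasCompactSupport
    (g := fun x => ‖fderiv ℝ u x‖ ^ 2) ((hu.continuous_fderiv one_ne_zero).norm.pow 2)
    hus.norm_fderiv_sq
  simpa using this

/-- The Caffarelli–Kohn–Nirenberg inequality in `ℝⁿ`, `n ≥ 3`, `0 ≤ a < (n−2)/2`,
`a ≤ b ≤ a+1`, `p = 2n/(n−2+2(b−a))`: there is `C > 0` with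
`C (∫ |x|^{−bp} |u|ᵖ)^{2/p} ≤ ∫ |x|^{−2a} |∇u|²` for all smooth compactly supported `u`. -/
theorem ckn_inequality_euclidean
    {n : ℕ} (hn : 3 ≤ n) (a b : ℝ) (ha0 : 0 ≤ a) (ha : a < ((n : ℝ) - 2) / 2)
    (hab : a ≤ b) (hba : b ≤ a + 1)
    (p : ℝ) (hp : p = 2 * (n : ℝ) / ((n : ℝ) - 2 + 2 * (b - a))) :
    ∃ C : ℝ, 0 < C ∧
      ∀ u : EuclideanSpace ℝ (Fin n) → ℝ,
        ContDiff ℝ (⊤ : ℕ∞) u → HasCompactSupport u →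
        C * (∫ x, ‖x‖ ^ (-(b * p)) * |u x| ^ p) ^ (2 / p)
          ≤ ∫ x, ‖x‖ ^ (-(2 * a)) * ‖fderiv ℝ u x‖ ^ 2 := by
  have hn3 : (3 : ℝ) ≤ n := by exact_mod_cast hn
  have hden : (0 : ℝ) < n - 2 + 2 * (b - a) := by linarith
  have hp0 : 0 < p := by rw [hp]; positivity
  obtain ⟨M, hM⟩ := exists_lintegral_regularized_le hn ha0 (by linarith) hab hba hp
  refine ⟨((M : ℝ) ^ (2 / p) + 1)⁻¹, by positivity, fun u hu hus => ?_⟩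
  have hu1 : ContDiff ℝ 1 u := hu.of_le (by exact_mod_cast le_top)
  have : Nonempty (Fin n) := ⟨⟨0, by lia⟩⟩
  have hne : ∀ᵐ x : EuclideanSpace ℝ (Fin n), x ≠ 0 := by
    simp [ae_iff]
  have hsq : ∀ (x : EuclideanSpace ℝ (Fin n)) (s : ℝ), (‖x‖ ^ 2) ^ s = ‖x‖ ^ (2 * s) := by
    intro x s
    rw [← Real.rpow_natCast_mul (norm_nonneg _)]
    norm_num
  set G := ∫ x, ‖x‖ ^ (-(2 * a)) * ‖fderiv ℝ u x‖ ^ 2 with hG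
  have hG0 : 0 ≤ G := integral_nonneg fun x => by positivity
  have hreg : ∀ ε > 0, ∫ x, (‖x‖ ^ 2 + ε) ^ (-a) * ‖fderiv ℝ u x‖ ^ 2 ≤ G := by
    intro ε hε
    refine integral_mono_of_nonneg (ae_of_all _ fun x => by positivity)
      (integrable_norm_rpow_mul_norm_fderiv_sq (by lia) (by linarith) hu1 hus) ?_
    filter_upwards [hne] with x hx
    have : 0 < ‖x‖ := norm_pos_iff.2 hx
    have h : (‖x‖ ^ 2 + ε) ^ (-a) ≤ (‖x‖ ^ 2) ^ (-a) :=
      Real.rpow_le_rpow_of_nonpos (by positivity) (by linarith) (by linarith)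
    rw [hsq, mul_neg] at h
    gcongr
  let ε : ℕ → ℝ := fun k => 1 / ((k : ℝ) + 1)
  have hε : ∀ k, 0 < ε k := fun k => Nat.one_div_pos_of_nat
  have hmeas : ∀ k, Measurable fun x : EuclideanSpace ℝ (Fin n) =>
      ENNReal.ofReal ((‖x‖ ^ 2 + ε k) ^ (-(b * p / 2)) * |u x| ^ p) := by
    have := hu1.continuous.measurable
    intro k
    fun_prop
  have hlim : ∀ᵐ x : EuclideanSpace ℝ (Fin n),
      ENNReal.ofReal (‖x‖ ^ (-(b * p)) * |u x| ^ p) = Filter.liminf (fun k =>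
        ENNReal.ofReal ((‖x‖ ^ 2 + ε k) ^ (-(b * p / 2)) * |u x| ^ p)) Filter.atTop := by
    filter_upwards [hne] with x hx
    have hx0 : 0 < ‖x‖ := norm_pos_iff.2 hx
    refine (Filter.Tendsto.liminf_eq ?_).symm
    refine ENNReal.tendsto_ofReal (Filter.Tendsto.mul_const _ ?_)
    have h1 : Filter.Tendsto (fun k => ‖x‖ ^ 2 + ε k) Filter.atTop (nhds (‖x‖ ^ 2)) := by
      simpa [ε] using tendsto_one_div_add_atTop_nhds_zero_nat.const_add (‖x‖ ^ 2)
    have h2 := h1.rpow_const (p := -(b * p / 2)) (Or.inl (by positivity))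
    rw [hsq] at h2
    convert h2 using 2
    ring_nf
  have hle : ∫⁻ x, ENNReal.ofReal (‖x‖ ^ (-(b * p)) * |u x| ^ p) ≤
      ENNReal.ofReal (M * G ^ (p / 2)) := by
    rw [lintegral_congr_ae hlim]
    refine (lintegral_liminf_le hmeas).trans (Filter.liminf_le_of_le ?_ fun c hc => ?_)
    · isBoundedDefault
    · obtain ⟨k, hk⟩ := hc.exists
      refine hk.trans ((hM (ε k) (hε k) u hu1 hus).trans ?_)
      rw [ENNReal.ofReal_mul M.coe_nonneg, ← ENNReal.ofReal_rpow_of_nonneg hG0 (by positivity),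
        ENNReal.ofReal_coe_nnreal]
      gcongr
      exact hreg _ (hε k)
  have hI : ∫ x, ‖x‖ ^ (-(b * p)) * |u x| ^ p ≤ M * G ^ (p / 2) := by
    have := hu1.continuous.measurable
    rw [integral_eq_lintegral_of_nonneg_ae (ae_of_all _ fun x => by positivity)
      (Measurable.aestronglyMeasurable (by fun_prop))]
    exact ENNReal.toReal_le_of_le_ofReal (by positivity) hle
  rw [inv_mul_le_iff₀ (by positivity)]
  calc _ ≤ (M * G ^ (p / 2)) ^ (2 / p) :=
        Real.rpow_le_rpow (integral_nonneg fun x => by positivity) hI (by positivity)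
    _ = (M : ℝ) ^ (2 / p) * G := by
      rw [Real.mul_rpow M.coe_nonneg (by positivity), ← Real.rpow_mul hG0]
      field_simp
      simp
    _ ≤ _ := by gcongr; linarith
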